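/- arXiv:0909.4015 — 8 statements merged into one kernel-verified Lean document; each statement's English description precedes it below -/
import Mathlib

section
/- Let N ∈ ℝ^(n×r) be the stoichiometric matrix of a mass-action network and let E ∈ ℝ_{≥0}^(r×p) be a generator matrix of the cone ker(N) ∩ ℝ_{≥0}^r, i.e. ker(N) ∩ ℝ_{≥0}^r = { E·λ : λ ∈ ℝ_{≥0}^p }. Let k ∈ ℝ_{>0}^r and a ∈ ℝ_{>0}^n. Then the positive vector a satisfies N·v(k,a) = 0 if and only if there exists λ ∈ Λ(E) := { λ ∈ ℝ_{≥0}^p : E·λ > 0 } such that k = diag(Φ(a^{-1}))·E·λ. -/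
open Matrix BigOperators

noncomputable section

/-- Componentwise monomial vector `Ψ(x) = (x^{y_1}, …, x^{y_m̄})`, where `y_i` is the
`i`-th column of `Yhat`. -/
def Psi {n mbar : ℕ} (Yhat : Matrix (Fin n) (Fin mbar) ℝ) (x : Fin n → ℝ) :
    Fin mbar → ℝ :=
  fun i => ∏ j, x j ^ Yhat j i

/-- `Φ(x) = (x^{y_{reac(1)}}, …, x^{y_{reac(r)}})`. -/
def Phi {n r mbar : ℕ} (Yhat : Matrix (Fin n) (Fin mbar) ℝ)
    (reac : Fin r → Fin mbar) (x : Fin n → ℝ) : Fin r → ℝ :=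
  fun i => Psi Yhat x (reac i)

/-- Mass-action rate vector `v(k,x) = diag(k)·Φ(x)`. -/
def rate {n r mbar : ℕ} (Yhat : Matrix (Fin n) (Fin mbar) ℝ)
    (reac : Fin r → Fin mbar) (k : Fin r → ℝ) (x : Fin n → ℝ) : Fin r → ℝ :=
  fun i => k i * Phi Yhat reac x i

/-- The 0/1 matrix `Π` whose `i`-th row is the unit row vector `e_{reac(i)}ᵀ`. -/
def PiMat {r mbar : ℕ} (reac : Fin r → Fin mbar) : Matrix (Fin r) (Fin mbar) ℝ :=
  fun i j => if reac i = j then 1 else 0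

/-- existence of positive steady states via the cone generator matrix `E`. -/
theorem statement0 {n r p : ℕ} {mbar : ℕ}
    (N : Matrix (Fin n) (Fin r) ℝ)
    (Yhat : Matrix (Fin n) (Fin mbar) ℝ) (reac : Fin r → Fin mbar)
    (E : Matrix (Fin r) (Fin p) ℝ)
    (hE : ∀ i j, 0 ≤ E i j)
    (hcone : ∀ w : Fin r → ℝ,
      (N.mulVec w = 0 ∧ ∀ i, 0 ≤ w i) ↔
        ∃ l : Fin p → ℝ, (∀ j, 0 ≤ l j) ∧ w = E.mulVec l)
    (k : Fin r → ℝ) (hk : ∀ i, 0 < k i)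
    (a : Fin n → ℝ) (ha : ∀ i, 0 < a i) :
    N.mulVec (rate Yhat reac k a) = 0 ↔
      ∃ l : Fin p → ℝ, (∀ j, 0 ≤ l j) ∧ (∀ i, 0 < E.mulVec l i) ∧
        k = fun i => Phi Yhat reac a⁻¹ i * E.mulVec l i := by
  have hpos : ∀ i, 0 < Phi Yhat reac a i := by
    intro i
    simp only [Phi, Psi]
    exact Finset.prod_pos fun j _ => Real.rpow_pos_of_pos (ha j) _
  have hinv : ∀ i, Phi Yhat reac a⁻¹ i = (Phi Yhat reac a i)⁻¹ := by
    intro i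
    simp only [Phi, Psi, Pi.inv_apply]
    rw [← Finset.prod_inv_distrib]
    exact Finset.prod_congr rfl fun j _ => Real.inv_rpow (ha j).le _
  have hr : ∀ i, 0 < rate Yhat reac k a i := fun i => mul_pos (hk i) (hpos i)
  constructor
  · intro h
    obtain ⟨l, hl, hw⟩ := (hcone _).1 ⟨h, fun i => (hr i).le⟩
    refine ⟨l, hl, fun i => hw ▸ hr i, ?_⟩
    funext i
    rw [← hw, hinv]
    have := (hpos i).ne'
    simp only [rate]
    field_simp
  · rintro ⟨l, hl, hp, hkk⟩
    have hw : rate Yhat reac k a = E.mulVec l := by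
      funext i
      have := (hpos i).ne'
      simp only [rate]
      rw [congrFun hkk i, hinv]
      field_simp
    exact ((hcone _).2 ⟨l, hl, hw⟩).1


end
end

section
/- Suppose ker(N) = span(E) for some E ∈ ℝ_{>0}^r and suppose reac is surjective (every reactant complex is the reactant of at least one reaction). Then ker(N·diag(E)·Π) = span(1_m̄), the one-dimensional span of the all-ones vector in ℝ^m̄. -/
open Matrix BigOperators

noncomputable section

/-- if `ker N = span E` with `E > 0` and `reac` is surjective, then
`ker (N·diag(E)·Π)` is the span of the all-ones vector in `ℝ^m̄`. -/
theorem statement4 {n r : ℕ} {mbar : ℕ}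
    (N : Matrix (Fin n) (Fin r) ℝ)
    (reac : Fin r → Fin mbar)
    (E : Fin r → ℝ) (hE : ∀ i, 0 < E i)
    (hker : ∀ w : Fin r → ℝ, N.mulVec w = 0 ↔ ∃ c : ℝ, w = c • E)
    (hsurj : Function.Surjective reac) :
    ∀ z : Fin mbar → ℝ,
      (N * Matrix.diagonal E * PiMat reac).mulVec z = 0 ↔
        ∃ c : ℝ, z = c • (fun _ => (1 : ℝ)) := by
  intro z
  have key : (Matrix.diagonal E * PiMat reac).mulVec z = fun i => E i * z (reac i) := by
    funext i
    simp [← Matrix.mulVec_mulVec, Matrix.mulVec_diagonal, Matrix.mulVec, dotProduct, PiMat,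
      Matrix.diagonal_mul]
  rw [Matrix.mul_assoc, ← Matrix.mulVec_mulVec, key, hker]
  refine exists_congr fun c => ⟨fun h => ?_, fun h => ?_⟩
  · funext j
    obtain ⟨i, rfl⟩ := hsurj j
    have h1 := congrFun h i
    simp only [Pi.smul_apply, smul_eq_mul] at h1 ⊢
    have h2 := (hE i).ne'
    rw [mul_one]
    exact mul_left_cancel₀ h2 (h1.trans (mul_comm _ _))
  · funext i
    simp [h, mul_comm]

end
end

section
/- Suppose the network is defined by a stoichiometric generator E (i.e. E ∈ ℝ_{>0}^r, ker(N) = span(E), and reac is surjective), with m̄ ≥ 1. Let a, b ∈ ℝ_{>0}^n and set k := diag(Φ(a^{-1}))·E. Then N·v(k,b) = 0 if and only if there exists α > 0 such that Ψ(b/a) = α·1_m̄, where b/a denotes the componentwise quotient. -/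
open Matrix BigOperators

noncomputable section

/-- for a network defined by a stoichiometric generator `E` and
`k := diag(Φ(a⁻¹))·E`, the positive vector `b` is a steady state iff
`Ψ(b/a) = α·1_m̄` for some `α > 0`. -/
theorem statement6 {n r : ℕ} {mbar : ℕ}
    (N : Matrix (Fin n) (Fin r) ℝ)
    (Yhat : Matrix (Fin n) (Fin mbar) ℝ) (reac : Fin r → Fin mbar)
    (E : Fin r → ℝ) (hE : ∀ i, 0 < E i)
    (hker : ∀ w : Fin r → ℝ, N.mulVec w = 0 ↔ ∃ c : ℝ, w = c • E)
    (hsurj : Function.Surjective reac)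
    (hm : 1 ≤ mbar)
    (a : Fin n → ℝ) (ha : ∀ i, 0 < a i)
    (b : Fin n → ℝ) (hb : ∀ i, 0 < b i) :
    N.mulVec (rate Yhat reac (fun i => Phi Yhat reac a⁻¹ i * E i) b) = 0 ↔
      ∃ α : ℝ, 0 < α ∧ Psi Yhat (b / a) = fun _ => α := by
  have key : rate Yhat reac (fun i => Phi Yhat reac a⁻¹ i * E i) b
      = fun i => Psi Yhat (b / a) (reac i) * E i := by
    funext i
    have h : Psi Yhat (b / a) (reac i) = Psi Yhat a⁻¹ (reac i) * Psi Yhat b (reac i) := by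
      unfold Psi
      rw [← Finset.prod_mul_distrib]
      refine Finset.prod_congr rfl fun j _ => ?_
      rw [← Real.mul_rpow (by simpa using (ha j).le) (hb j).le]
      congr 1
      simp [div_eq_mul_inv, mul_comm]
    simp only [rate, Phi]
    rw [h]
    ring
  rw [key, hker]
  constructor
  · rintro ⟨c, hc⟩
    have hc' : ∀ m, Psi Yhat (b / a) m = c := by
      intro m
      obtain ⟨i, rfl⟩ := hsurj m
      have := congrFun hc i
      simp only [Pi.smul_apply, smul_eq_mul] at this
      exact mul_right_cancel₀ (hE i).ne' this
    refine ⟨c, ?_, funext hc'⟩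
    rw [← hc' ⟨0, hm⟩]
    exact Finset.prod_pos fun j _ => Real.rpow_pos_of_pos (div_pos (hb j) (ha j)) _
  · rintro ⟨c, _, hc⟩
    exact ⟨c, by funext i; simp [hc]⟩

end
end

section
/- (Parameterizing positive steady state solutions.) Let N ∈ ℝ^(n×r) be the stoichiometric matrix and let E ∈ ℝ_{>0}^r satisfy N·E = 0. Let a ∈ ℝ_{>0}^n, λ > 0, and set k := λ·diag(Φ(a^{-1}))·E. Suppose μ ∈ ℝ^n and ρ > 0 satisfy Ŷ^T·μ = ρ·1_m̄, and define b := diag(e^μ)·a (i.e. b_i = e^{μ_i}·a_i for all i). Then both N·v(k,a) = 0 and N·v(k,b) = 0 hold. -/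
open Matrix BigOperators

noncomputable section

/-- Parameterizing positive steady state solutions: if
`Ŷᵀμ = ρ·1_m̄` with `ρ > 0` and `b := diag(e^μ)·a`, then both `a` and `b` are
steady states for `k := λ·diag(Φ(a⁻¹))·E`. -/
theorem statement8 {n r : ℕ} {mbar : ℕ}
    (N : Matrix (Fin n) (Fin r) ℝ)
    (Yhat : Matrix (Fin n) (Fin mbar) ℝ) (reac : Fin r → Fin mbar)
    (E : Fin r → ℝ) (hE : ∀ i, 0 < E i) (hNE : N.mulVec E = 0)
    (a : Fin n → ℝ) (ha : ∀ i, 0 < a i)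
    (lam : ℝ) (hlam : 0 < lam)
    (k : Fin r → ℝ) (hk : k = fun i => lam * (Phi Yhat reac a⁻¹ i * E i))
    (μ : Fin n → ℝ) (ρ : ℝ) (hρ : 0 < ρ)
    (hμ : Yhat.transpose.mulVec μ = fun _ => ρ)
    (b : Fin n → ℝ) (hb : b = fun i => Real.exp (μ i) * a i) :
    N.mulVec (rate Yhat reac k a) = 0 ∧ N.mulVec (rate Yhat reac k b) = 0 := by
  have h1 : ∀ i, Phi Yhat reac a⁻¹ i * Phi Yhat reac a i = 1 := by
    intro i
    simp only [Phi, Psi]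
    rw [← Finset.prod_mul_distrib]
    apply Finset.prod_eq_one
    intro j _
    rw [Pi.inv_apply, Real.inv_rpow (ha j).le]
    exact inv_mul_cancel₀ (Real.rpow_pos_of_pos (ha j) _).ne'
  have h2 : ∀ i, Phi Yhat reac b i = Real.exp ρ * Phi Yhat reac a i := by
    intro i
    have hm := congrFun hμ (reac i)
    simp only [Matrix.mulVec, dotProduct, Matrix.transpose_apply] at hm
    simp only [Phi, Psi, hb]
    rw [← hm, Real.exp_sum, ← Finset.prod_mul_distrib]
    apply Finset.prod_congr rfl
    intro j _
    rw [Real.mul_rpow (Real.exp_pos _).le (ha j).le, ← Real.exp_mul, mul_comm (μ j)]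
  have ea : rate Yhat reac k a = lam • E := by
    funext i
    simp only [rate, hk, Pi.smul_apply, smul_eq_mul]
    linear_combination lam * E i * h1 i
  have eb : rate Yhat reac k b = (Real.exp ρ * lam) • E := by
    funext i
    simp only [rate, hk, Pi.smul_apply, smul_eq_mul, h2]
    linear_combination Real.exp ρ * lam * E i * h1 i
  rw [ea, eb, Matrix.mulVec_smul, Matrix.mulVec_smul, hNE]
  simp

end
end

section
/- Let N ∈ ℝ^(n×r) be the stoichiometric matrix, let E ∈ ℝ_{>0}^r satisfy N·E = 0, and assume m̄ ≥ 1. Suppose there exist μ₀ ∈ ℝ^n and ρ₀ > 0 with Ŷ^T·μ₀ = ρ₀·1_m̄. Fix a ∈ ℝ_{>0}^n and set k := diag(Φ(a^{-1}))·E. Then the set of positive steady states { b ∈ ℝ_{>0}^n : N·v(k,b) = 0 } is infinite. -/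
open Matrix BigOperators

noncomputable section

/-- under the solvability of `Ŷᵀμ = ρ·1_m̄` with `ρ > 0`, a fixed
positive `a` with `k := diag(Φ(a⁻¹))·E` yields infinitely many positive steady
states. -/
theorem statement9 {n r : ℕ} {mbar : ℕ}
    (N : Matrix (Fin n) (Fin r) ℝ)
    (Yhat : Matrix (Fin n) (Fin mbar) ℝ) (reac : Fin r → Fin mbar)
    (E : Fin r → ℝ) (hE : ∀ i, 0 < E i) (hNE : N.mulVec E = 0)
    (hm : 1 ≤ mbar)
    (μ₀ : Fin n → ℝ) (ρ₀ : ℝ) (hρ₀ : 0 < ρ₀)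
    (hμ₀ : Yhat.transpose.mulVec μ₀ = fun _ => ρ₀)
    (a : Fin n → ℝ) (ha : ∀ i, 0 < a i) :
    { b : Fin n → ℝ | (∀ i, 0 < b i) ∧
      N.mulVec (rate Yhat reac (fun i => Phi Yhat reac a⁻¹ i * E i) b) = 0 }.Infinite := by
  have hne : ∃ j, μ₀ j ≠ 0 := by
    by_contra! h
    have h1 := congrFun hμ₀ ⟨0, hm⟩
    simp [Matrix.mulVec, dotProduct, h] at h1
    exact hρ₀.ne h1
  obtain ⟨j0, hj0⟩ := hne
  refine Set.infinite_of_injective_forall_mem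
    (f := fun t : ℝ => fun j => a j * Real.exp (t * μ₀ j)) ?_ ?_
  · intro s t hst
    have h1 := congrFun hst j0
    have h2 := Real.exp_injective (mul_left_cancel₀ (ha j0).ne' h1)
    exact mul_right_cancel₀ hj0 h2
  · intro t
    refine ⟨fun i => mul_pos (ha i) (Real.exp_pos _), ?_⟩
    have key : rate Yhat reac (fun i => Phi Yhat reac a⁻¹ i * E i)
        (fun j => a j * Real.exp (t * μ₀ j)) = Real.exp (t * ρ₀) • E := by
      funext i
      have h1 := congrFun hμ₀ (reac i)
      simp only [Matrix.mulVec, dotProduct, Matrix.transpose_apply] at h1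
      have h2 : (∏ j, (a⁻¹) j ^ Yhat j (reac i)) *
          ∏ j, (a j * Real.exp (t * μ₀ j)) ^ Yhat j (reac i) = Real.exp (t * ρ₀) := by
        rw [← Finset.prod_mul_distrib, ← h1, Finset.mul_sum, Real.exp_sum]
        refine Finset.prod_congr rfl fun j _ => ?_
        have hp := Real.rpow_pos_of_pos (ha j) (Yhat j (reac i))
        rw [Pi.inv_apply, Real.inv_rpow (ha j).le,
          Real.mul_rpow (ha j).le (Real.exp_pos _).le, ← Real.exp_mul,
          inv_mul_cancel_left₀ hp.ne']
        congr 1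
        ring
      simp only [rate, Phi, Psi, Pi.smul_apply, smul_eq_mul]
      rw [← h2]
      ring
    rw [key, Matrix.mulVec_smul, hNE, smul_zero]

end
end

section
/- Let m1, m2 ∈ ℝ^n with σ(m1) = σ(m2). Define p ∈ ℝ^n by p_i := m2_i/(e^{m1_i} − 1) if m1_i ≠ 0 and p_i := 1 (or any prescribed positive number) if m1_i = 0, and define q ∈ ℝ^n by q_i := e^{m1_i}·p_i. Then p and q are componentwise strictly positive and satisfy ln(q) − ln(p) = m1 and q − p = m2, where ln is taken componentwise. -/
open Matrix BigOperators

noncomputable section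

/-- the explicit formulas `p_i = m2_i/(e^{m1_i} - 1)` (with an
arbitrary positive value where `m1_i = 0`) and `q_i = e^{m1_i}·p_i` yield positive
vectors with `ln q - ln p = m1` and `q - p = m2`. -/
theorem statement12 {n : ℕ}
    (m1 m2 : Fin n → ℝ)
    (hsign : ∀ i, Real.sign (m1 i) = Real.sign (m2 i))
    (pbar : Fin n → ℝ) (hpbar : ∀ i, 0 < pbar i)
    (p q : Fin n → ℝ)
    (hp : ∀ i, p i = if m1 i ≠ 0 then m2 i / (Real.exp (m1 i) - 1) else pbar i)
    (hq : ∀ i, q i = Real.exp (m1 i) * p i) :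
    (∀ i, 0 < p i) ∧ (∀ i, 0 < q i) ∧
    (fun i => Real.log (q i) - Real.log (p i)) = m1 ∧ q - p = m2 := by
  have key : ∀ i, 0 < p i ∧ Real.exp (m1 i) * p i - p i = m2 i := by
    intro i
    have hs := hsign i
    have hpi := hp i
    rcases lt_trichotomy (m1 i) 0 with h | h | h
    · rw [if_pos h.ne] at hpi
      have h2 : m2 i < 0 := by
        rw [Real.sign_of_neg h] at hs
        rcases lt_trichotomy (m2 i) 0 with h' | h' | h'
        · exact h'
        · rw [h', Real.sign_zero] at hs; norm_num at hs
        · rw [Real.sign_of_pos h'] at hs; norm_num at hs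
      have he : Real.exp (m1 i) - 1 < 0 := by
        have := Real.exp_lt_one_iff.mpr h
        linarith
      refine ⟨by rw [hpi]; exact div_pos_of_neg_of_neg h2 he, ?_⟩
      have : p i * (Real.exp (m1 i) - 1) = m2 i := by
        rw [hpi]; exact div_mul_cancel₀ _ he.ne
      linarith
    · rw [if_neg (by simp [h])] at hpi
      have h2 : m2 i = 0 := by
        rw [h, Real.sign_zero] at hs
        exact Real.sign_eq_zero_iff.mp hs.symm
      refine ⟨by rw [hpi]; exact hpbar i, ?_⟩
      rw [h, h2, Real.exp_zero]; ring
    · rw [if_pos h.ne'] at hpi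
      have h2 : 0 < m2 i := by
        rw [Real.sign_of_pos h] at hs
        rcases lt_trichotomy (m2 i) 0 with h' | h' | h'
        · rw [Real.sign_of_neg h'] at hs; norm_num at hs
        · rw [h', Real.sign_zero] at hs; norm_num at hs
        · exact h'
      have he : 0 < Real.exp (m1 i) - 1 := by
        have := Real.one_lt_exp_iff.mpr h
        linarith
      refine ⟨by rw [hpi]; exact div_pos h2 he, ?_⟩
      have : p i * (Real.exp (m1 i) - 1) = m2 i := by
        rw [hpi]; exact div_mul_cancel₀ _ he.ne'
      linarith
  refine ⟨fun i => (key i).1, fun i => ?_, ?_, ?_⟩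
  · rw [hq i]; exact mul_pos (Real.exp_pos _) (key i).1
  · funext i
    simp only [hq i]
    rw [Real.log_mul (Real.exp_pos _).ne' (key i).1.ne', Real.log_exp]
    ring
  · funext i
    rw [Pi.sub_apply, hq i]; exact (key i).2

end
end

section
/- Let M1 ⊆ ℝ^n and M2 ⊆ ℝ^n be two nonempty subsets of ℝ^n. There exist componentwise strictly positive vectors p, q ∈ ℝ_{>0}^n with ln(q) − ln(p) ∈ M1 and q − p ∈ M2 if and only if there exist m1 ∈ M1 and m2 ∈ M2 with σ(m1) = σ(m2). Moreover, given such m1 and m2, one may take p_i := m2_i/(e^{m1_i} − 1) whenever m1_i ≠ 0, p_i an arbitrary positive number whenever m1_i = 0, and q_i := e^{m1_i}·p_i. -/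
open Matrix BigOperators

noncomputable section

theorem aux13_scalar (a b c p q : ℝ) (h : Real.sign a = Real.sign b) (hc : 0 < c)
    (hp : p = if a ≠ 0 then b / (Real.exp a - 1) else c) (hq : q = Real.exp a * p) :
    0 < p ∧ 0 < q ∧ Real.log q - Real.log p = a ∧ q - p = b := by
  have key : 0 < p ∧ q - p = b := by
    rcases lt_trichotomy a 0 with ha | ha | ha
    · have hb : b < 0 := by
        rw [Real.sign_of_neg ha] at h
        rcases lt_trichotomy b 0 with hb | hb | hb
        · exact hb
        · rw [hb, Real.sign_zero] at h; norm_num at h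
        · rw [Real.sign_of_pos hb] at h; norm_num at h
      have he : Real.exp a - 1 < 0 := by linarith [Real.exp_lt_one_iff.mpr ha]
      rw [if_pos ha.ne] at hp
      refine ⟨hp ▸ div_pos_of_neg_of_neg hb he, ?_⟩
      have : p * (Real.exp a - 1) = b := by rw [hp]; exact div_mul_cancel₀ _ he.ne
      rw [hq]; linarith
    · subst ha
      rw [Real.sign_zero] at h
      have hb : b = 0 := Real.sign_eq_zero_iff.mp h.symm
      simp at hp hq
      exact ⟨hp ▸ hc, by rw [hq, hb, sub_self]⟩
    · have hb : 0 < b := by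
        rw [Real.sign_of_pos ha] at h
        rcases lt_trichotomy b 0 with hb | hb | hb
        · rw [Real.sign_of_neg hb] at h; norm_num at h
        · rw [hb, Real.sign_zero] at h; norm_num at h
        · exact hb
      have he : 0 < Real.exp a - 1 := by linarith [Real.one_lt_exp_iff.mpr ha]
      rw [if_pos ha.ne.symm] at hp
      refine ⟨hp ▸ div_pos hb he, ?_⟩
      have : p * (Real.exp a - 1) = b := by rw [hp]; exact div_mul_cancel₀ _ he.ne.symm
      rw [hq]; linarith
  refine ⟨key.1, ?_, ?_, key.2⟩
  · rw [hq]; exact mul_pos (Real.exp_pos a) key.1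
  · rw [hq, Real.log_mul (Real.exp_pos a).ne.symm key.1.ne.symm, Real.log_exp]; ring

theorem aux13_sign (p q : ℝ) (hp : 0 < p) (hq : 0 < q) :
    Real.sign (Real.log q - Real.log p) = Real.sign (q - p) := by
  rcases lt_trichotomy q p with h | h | h
  · rw [Real.sign_of_neg (sub_neg.mpr h),
      Real.sign_of_neg (sub_neg.mpr (Real.log_lt_log hq h))]
  · simp [h]
  · rw [Real.sign_of_pos (sub_pos.mpr h),
      Real.sign_of_pos (sub_pos.mpr (Real.log_lt_log hp h))]

/-- positive vectors `p, q` with `ln q - ln p ∈ M1` and `q - p ∈ M2`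
exist iff `M1` and `M2` contain vectors with the same sign pattern; moreover such
`p, q` are given by the explicit formulas of the lemma. -/
theorem statement13 {n : ℕ}
    (M1 M2 : Set (Fin n → ℝ)) (hM1 : M1.Nonempty) (hM2 : M2.Nonempty) :
    ((∃ p q : Fin n → ℝ, (∀ i, 0 < p i) ∧ (∀ i, 0 < q i) ∧
        (fun i => Real.log (q i) - Real.log (p i)) ∈ M1 ∧ q - p ∈ M2) ↔
      (∃ m1 ∈ M1, ∃ m2 ∈ M2, ∀ i, Real.sign (m1 i) = Real.sign (m2 i))) ∧
    (∀ m1 ∈ M1, ∀ m2 ∈ M2, (∀ i, Real.sign (m1 i) = Real.sign (m2 i)) →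
      ∀ pbar : Fin n → ℝ, (∀ i, 0 < pbar i) →
      ∀ p q : Fin n → ℝ,
        (∀ i, p i = if m1 i ≠ 0 then m2 i / (Real.exp (m1 i) - 1) else pbar i) →
        (∀ i, q i = Real.exp (m1 i) * p i) →
        (∀ i, 0 < p i) ∧ (∀ i, 0 < q i) ∧
        (fun i => Real.log (q i) - Real.log (p i)) ∈ M1 ∧ q - p ∈ M2) := by
  have second : ∀ m1 ∈ M1, ∀ m2 ∈ M2, (∀ i, Real.sign (m1 i) = Real.sign (m2 i)) →
      ∀ pbar : Fin n → ℝ, (∀ i, 0 < pbar i) →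
      ∀ p q : Fin n → ℝ,
        (∀ i, p i = if m1 i ≠ 0 then m2 i / (Real.exp (m1 i) - 1) else pbar i) →
        (∀ i, q i = Real.exp (m1 i) * p i) →
        (∀ i, 0 < p i) ∧ (∀ i, 0 < q i) ∧
        (fun i => Real.log (q i) - Real.log (p i)) ∈ M1 ∧ q - p ∈ M2 := by
    intro m1 h1 m2 h2 hs pbar hb p q hp hq
    have H := fun i => aux13_scalar _ _ _ _ _ (hs i) (hb i) (hp i) (hq i)
    refine ⟨fun i => (H i).1, fun i => (H i).2.1, ?_, ?_⟩
    · have : (fun i => Real.log (q i) - Real.log (p i)) = m1 := funext fun i => (H i).2.2.1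
      rw [this]; exact h1
    · have : q - p = m2 := funext fun i => (H i).2.2.2
      rw [this]; exact h2
  refine ⟨⟨?_, ?_⟩, second⟩
  · rintro ⟨p, q, hp, hq, h1, h2⟩
    exact ⟨_, h1, _, h2, fun i => aux13_sign _ _ (hp i) (hq i)⟩
  · rintro ⟨m1, h1, m2, h2, hs⟩
    exact ⟨_, _, second m1 h1 m2 h2 hs (fun _ => 1) (fun _ => one_pos) _ _
      (fun _ => rfl) (fun _ => rfl)⟩

end
end

section
/- (Sign-pattern criterion for V-multistationarity.) Suppose the network is defined by a stoichiometric generator E (i.e. E ∈ ℝ_{>0}^r, ker(N) = span(E), and reac is surjective), with m̄ ≥ 1. Let V ⊆ ℝ^n be a linear subspace and let M := { μ ∈ ℝ^n : there exists ρ > 0 with Ŷ^T·μ = ρ·1_m̄ }. If there exist μ ∈ M and s ∈ V with σ(μ) = σ(s), then the network exhibits V-multistationarity: there exist k ∈ ℝ_{>0}^r and two distinct positive vectors a, b ∈ ℝ_{>0}^n with N·v(k,a) = 0, N·v(k,b) = 0 and b − a ∈ V. -/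
open Matrix BigOperators

noncomputable section

/-- Sign-pattern criterion for V-multistationarity. -/
theorem statement14 {n r : ℕ} {mbar : ℕ}
    (N : Matrix (Fin n) (Fin r) ℝ)
    (Yhat : Matrix (Fin n) (Fin mbar) ℝ) (reac : Fin r → Fin mbar)
    (E : Fin r → ℝ) (hE : ∀ i, 0 < E i)
    (hker : ∀ w : Fin r → ℝ, N.mulVec w = 0 ↔ ∃ c : ℝ, w = c • E)
    (hsurj : Function.Surjective reac)
    (hm : 1 ≤ mbar)
    (V : Submodule ℝ (Fin n → ℝ))
    (μ : Fin n → ℝ) (ρ : ℝ) (hρ : 0 < ρ)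
    (hμ : Yhat.transpose.mulVec μ = fun _ => ρ)
    (s : Fin n → ℝ) (hs : s ∈ V)
    (hsign : ∀ i, Real.sign (μ i) = Real.sign (s i)) :
    ∃ (k : Fin r → ℝ) (a b : Fin n → ℝ),
      (∀ i, 0 < k i) ∧ (∀ i, 0 < a i) ∧ (∀ i, 0 < b i) ∧ a ≠ b ∧
      N.mulVec (rate Yhat reac k a) = 0 ∧
      N.mulVec (rate Yhat reac k b) = 0 ∧
      b - a ∈ V := by
  obtain ⟨a, ha, hab⟩ : ∃ a : Fin n → ℝ, (∀ i, 0 < a i) ∧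
      ∀ i, a i * Real.exp (μ i) - a i = s i := by
    have key : ∀ i, ∃ x : ℝ, 0 < x ∧ x * Real.exp (μ i) - x = s i := by
      intro i
      have h := hsign i
      rcases lt_trichotomy (μ i) 0 with h0 | h0 | h0
      · rw [Real.sign_of_neg h0] at h
        have hs0 : s i < 0 := by
          rcases lt_trichotomy (s i) 0 with h1 | h1 | h1
          · exact h1
          · rw [h1, Real.sign_zero] at h; norm_num at h
          · rw [Real.sign_of_pos h1] at h; norm_num at h
        have he : Real.exp (μ i) - 1 < 0 := by
          have := Real.exp_lt_one_iff.mpr h0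
          linarith
        refine ⟨s i / (Real.exp (μ i) - 1), div_pos_of_neg_of_neg hs0 he, ?_⟩
        have := div_mul_cancel₀ (s i) he.ne
        linarith
      · rw [h0, Real.sign_zero] at h
        have hs0 : s i = 0 := Real.sign_eq_zero_iff.mp h.symm
        exact ⟨1, one_pos, by simp [h0, hs0]⟩
      · rw [Real.sign_of_pos h0] at h
        have hs0 : 0 < s i := by
          rcases lt_trichotomy (s i) 0 with h1 | h1 | h1
          · rw [Real.sign_of_neg h1] at h; norm_num at h
          · rw [h1, Real.sign_zero] at h; norm_num at h
          · exact h1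
        have he : 0 < Real.exp (μ i) - 1 := by
          have := Real.one_lt_exp_iff.mpr h0
          linarith
        refine ⟨s i / (Real.exp (μ i) - 1), div_pos hs0 he, ?_⟩
        have := div_mul_cancel₀ (s i) he.ne'
        linarith
    choose a h1 h2 using key
    exact ⟨a, h1, h2⟩
  have hpos : ∀ i, 0 < Psi Yhat a i := fun i =>
    Finset.prod_pos fun j _ => Real.rpow_pos_of_pos (ha j) _
  have hb : ∀ i, Psi Yhat (fun j => a j * Real.exp (μ j)) i = Psi Yhat a i * Real.exp ρ := by
    intro i
    have h := congrFun hμ i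
    simp only [Matrix.mulVec, dotProduct, Matrix.transpose_apply] at h
    unfold Psi
    rw [← h, Real.exp_sum, ← Finset.prod_mul_distrib]
    refine Finset.prod_congr rfl fun j _ => ?_
    rw [Real.mul_rpow (ha j).le (Real.exp_pos _).le, ← Real.exp_mul, mul_comm (μ j)]
  refine ⟨fun i => E i / Psi Yhat a (reac i), a, fun j => a j * Real.exp (μ j),
    fun i => div_pos (hE i) (hpos _), ha, fun i => mul_pos (ha i) (Real.exp_pos _), ?_, ?_, ?_, ?_⟩
  · intro h
    have hμ0 : μ = 0 := by
      funext j
      have h1 := congrFun h j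
      have h2 : Real.exp (μ j) = 1 := by
        have h3 := (ha j).ne'
        apply mul_left_cancel₀ h3
        simpa using h1.symm
      simpa using h2
    have h := congrFun hμ ⟨0, hm⟩
    rw [hμ0] at h
    simp at h
    exact hρ.ne h
  · refine (hker _).mpr ⟨1, ?_⟩
    funext i
    simp only [rate, Phi, one_smul]
    exact div_mul_cancel₀ _ (hpos _).ne'
  · refine (hker _).mpr ⟨Real.exp ρ, ?_⟩
    funext i
    simp only [rate, Phi, hb, Pi.smul_apply, smul_eq_mul]
    rw [← mul_assoc, div_mul_cancel₀ _ (hpos _).ne', mul_comm]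
  · convert hs using 1
    funext i
    exact hab i

end
end
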